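/- Assume: (i) for every x ∈ X, 𝒟(x) is nonempty and for every t > 0 the set {F(x, y) : (y, u) ∈ 𝒟ᵗ(x)} is bounded above; (ii) ψ_p is lower semicontinuous at x̄, i.e. liminf_{x → x̄} ψ_p(x) ≥ ψ_p(x̄); (iii) there exists r̄ > 0 such that for every x with ‖x − x̄‖ < r̄ and every sequence (t_j, u_j) with t_j > 0, t_j → 0 and u_j → x, one has limsup_j ψ_p^{t_j}(u_j) ≤ ψ_p(x); (iv) (t_k) is a sequence of positive reals with t_k → 0, and for each k there is r^k > 0 such that x^k ∈ X satisfies ψ_p^{t_k}(x^k) ≤ ψ_p^{t_k}(x) for all x ∈ X with ‖x − x^k‖ < r^k; (v) x^k → x̄; and (vi) for every x ∈ X with ‖x − x̄‖ < r̄, dist(x, X ∩ {z : ‖z − x^k‖ < r^k}) → 0 as k → ∞. Then x̄ ∈ X and ψ_p(x̄) ≤ ψ_p(x) for all x ∈ X with ‖x − x̄‖ < r̄, i.e. x̄ is a local optimal solution of the KKT reformulation. -/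

import Mathlib

open Filter Topology Metric Set

noncomputable section

abbrev Euc (n : ℕ) : Type := EuclideanSpace ℝ (Fin n)

/-- Gradient with respect to the first variable. -/
noncomputable def gradX {n m : ℕ} (h : Euc n × Euc m → ℝ) (x : Euc n) (y : Euc m) : Euc n :=
  gradient (fun x' => h (x', y)) x

/-- Gradient with respect to the second variable. -/
noncomputable def gradY {n m : ℕ} (h : Euc n × Euc m → ℝ) (x : Euc n) (y : Euc m) : Euc m :=
  gradient (fun y' => h (x, y')) y

/-- `ℒ(x,y,u)`: gradient w.r.t. `y` of the lower-level Lagrangian. -/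
noncomputable def lagGrad {n m q : ℕ} (f : Euc n × Euc m → ℝ) (g : Fin q → Euc n × Euc m → ℝ)
    (x : Euc n) (y : Euc m) (u : Euc q) : Euc m :=
  gradY (fun p => f p + ∑ i, u i * g i p) x y

/-- The KKT set-valued map `𝒟(x)`. -/
def DSet {n m q : ℕ} (f : Euc n × Euc m → ℝ) (g : Fin q → Euc n × Euc m → ℝ) (x : Euc n) :
    Set (Euc m × Euc q) :=
  {p | lagGrad f g x p.1 p.2 = 0 ∧
    ∀ i, 0 ≤ p.2 i ∧ g i (x, p.1) ≤ 0 ∧ p.2 i * g i (x, p.1) = 0}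

/-- The Scholtes relaxation `𝒟ᵗ(x)`. -/
def DtSet {n m q : ℕ} (f : Euc n × Euc m → ℝ) (g : Fin q → Euc n × Euc m → ℝ) (t : ℝ)
    (x : Euc n) : Set (Euc m × Euc q) :=
  {p | lagGrad f g x p.1 p.2 = 0 ∧
    ∀ i, 0 ≤ p.2 i ∧ g i (x, p.1) ≤ 0 ∧ -(p.2 i * g i (x, p.1)) ≤ t}

/-- `ψ_p(x)`. -/
noncomputable def psiP {n m q : ℕ} (F f : Euc n × Euc m → ℝ) (g : Fin q → Euc n × Euc m → ℝ)
    (x : Euc n) : ℝ :=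
  sSup ((fun p : Euc m × Euc q => F (x, p.1)) '' DSet f g x)

/-- `ψ_pᵗ(x)`. -/
noncomputable def psiPt {n m q : ℕ} (F f : Euc n × Euc m → ℝ) (g : Fin q → Euc n × Euc m → ℝ)
    (t : ℝ) (x : Euc n) : ℝ :=
  sSup ((fun p : Euc m × Euc q => F (x, p.1)) '' DtSet f g t x)

/-- Maximizer set `S_p(x)`. -/
def SpSet {n m q : ℕ} (F f : Euc n × Euc m → ℝ) (g : Fin q → Euc n × Euc m → ℝ) (x : Euc n) :
    Set (Euc m × Euc q) :=
  {p | p ∈ DSet f g x ∧ ∀ p' ∈ DSet f g x, F (x, p'.1) ≤ F (x, p.1)}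

/-- Maximizer set `S_pᵗ(x)`. -/
def SpTSet {n m q : ℕ} (F f : Euc n × Euc m → ℝ) (g : Fin q → Euc n × Euc m → ℝ) (t : ℝ)
    (x : Euc n) : Set (Euc m × Euc q) :=
  {p | p ∈ DtSet f g t x ∧ ∀ p' ∈ DtSet f g t x, F (x, p'.1) ≤ F (x, p.1)}

/-- Upper-level feasible set `X`. -/
def upperX {n p : ℕ} (G : Fin p → Euc n → ℝ) : Set (Euc n) := {x | ∀ j, G j x ≤ 0}

/-- Upper-level regularity (MFCQ for the upper-level constraints). -/
def UpperLevelRegular {n p : ℕ} (G : Fin p → Euc n → ℝ) (x : Euc n) : Prop :=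
  ∀ α : Fin p → ℝ, (∀ j, 0 ≤ α j) → (∀ j, α j * G j x = 0) →
    (∑ j, α j • gradient (G j) x) = 0 → α = 0

/-- `∇_xℒ_l(x,y,u)`. -/
noncomputable def gradXL {n m q : ℕ} (f : Euc n × Euc m → ℝ) (g : Fin q → Euc n × Euc m → ℝ)
    (x : Euc n) (y : Euc m) (u : Euc q) (l : Fin m) : Euc n :=
  gradX (fun p => lagGrad f g p.1 p.2 u l) x y

/-- `∇_yℒ_l(x,y,u)`. -/
noncomputable def gradYL {n m q : ℕ} (f : Euc n × Euc m → ℝ) (g : Fin q → Euc n × Euc m → ℝ)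
    (x : Euc n) (y : Euc m) (u : Euc q) (l : Fin m) : Euc m :=
  gradY (fun p => lagGrad f g p.1 p.2 u l) x y

/-- The M-multiplier set `Λᵉᵐ(x,y,u,v)`. -/
def LambdaEM {n m q : ℕ} (f : Euc n × Euc m → ℝ) (g : Fin q → Euc n × Euc m → ℝ)
    (x : Euc n) (y : Euc m) (u : Euc q) (v : Euc n × Euc m) :
    Set ((Fin m → ℝ) × (Fin q → ℝ)) :=
  {bg | v + (∑ l, bg.1 l • (gradXL f g x y u l, gradYL f g x y u l))
        + (∑ i, bg.2 i • (gradX (g i) x y, gradY (g i) x y)) = 0 ∧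
    (∀ i, 0 < u i ∧ g i (x, y) = 0 → (∑ l, bg.1 l * gradY (g i) x y l) = 0) ∧
    (∀ i, u i = 0 ∧ g i (x, y) < 0 → bg.2 i = 0) ∧
    (∀ i, u i = 0 ∧ g i (x, y) = 0 →
      (0 < bg.2 i ∧ 0 < ∑ l, bg.1 l * gradY (g i) x y l) ∨
        bg.2 i * (∑ l, bg.1 l * gradY (g i) x y l) = 0)}

/-- The M-multiplier set `Λ_yᵉᵐ(x,y,u,w)`. -/
def LambdaYEM {n m q : ℕ} (f : Euc n × Euc m → ℝ) (g : Fin q → Euc n × Euc m → ℝ)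
    (x : Euc n) (y : Euc m) (u : Euc q) (w : Euc m) :
    Set ((Fin m → ℝ) × (Fin q → ℝ)) :=
  {bg | w + (∑ l, bg.1 l • gradYL f g x y u l) + (∑ i, bg.2 i • gradY (g i) x y) = 0 ∧
    (∀ i, 0 < u i ∧ g i (x, y) = 0 → (∑ l, bg.1 l * gradY (g i) x y l) = 0) ∧
    (∀ i, u i = 0 ∧ g i (x, y) < 0 → bg.2 i = 0) ∧
    (∀ i, u i = 0 ∧ g i (x, y) = 0 →
      (0 < bg.2 i ∧ 0 < ∑ l, bg.1 l * gradY (g i) x y l) ∨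
        bg.2 i * (∑ l, bg.1 l * gradY (g i) x y l) = 0)}

/-- Condition `(A₁ᵐ)`. -/
def A1m {n m q : ℕ} (f : Euc n × Euc m → ℝ) (g : Fin q → Euc n × Euc m → ℝ)
    (x : Euc n) (y : Euc m) (u : Euc q) : Prop :=
  ∀ bg ∈ LambdaEM f g x y u 0, bg.1 = 0 ∧ bg.2 = 0

/-- Condition `(A₂ᵐ)`. -/
def A2m {n m q : ℕ} (f : Euc n × Euc m → ℝ) (g : Fin q → Euc n × Euc m → ℝ)
    (x : Euc n) (y : Euc m) (u : Euc q) : Prop :=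
  ∀ bg ∈ LambdaYEM f g x y u 0,
    (∑ l, bg.1 l • gradXL f g x y u l) + (∑ i, bg.2 i • gradX (g i) x y) = 0

/-- The C-multiplier set `Λᵉᶜ(x,y,u,v)`. -/
def LambdaEC {n m q : ℕ} (f : Euc n × Euc m → ℝ) (g : Fin q → Euc n × Euc m → ℝ)
    (x : Euc n) (y : Euc m) (u : Euc q) (v : Euc n × Euc m) :
    Set ((Fin m → ℝ) × (Fin q → ℝ)) :=
  {bg | v + (∑ l, bg.1 l • (gradXL f g x y u l, gradYL f g x y u l))
        + (∑ i, bg.2 i • (gradX (g i) x y, gradY (g i) x y)) = 0 ∧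
    (∀ i, 0 < u i ∧ g i (x, y) = 0 → (∑ l, bg.1 l * gradY (g i) x y l) = 0) ∧
    (∀ i, u i = 0 ∧ g i (x, y) < 0 → bg.2 i = 0) ∧
    (∀ i, u i = 0 ∧ g i (x, y) = 0 →
      0 ≤ bg.2 i * (∑ l, bg.1 l * gradY (g i) x y l))}

/-- The C-multiplier set `Λ_yᵉᶜ(x,y,u,w)`. -/
def LambdaYEC {n m q : ℕ} (f : Euc n × Euc m → ℝ) (g : Fin q → Euc n × Euc m → ℝ)
    (x : Euc n) (y : Euc m) (u : Euc q) (w : Euc m) :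
    Set ((Fin m → ℝ) × (Fin q → ℝ)) :=
  {bg | w + (∑ l, bg.1 l • gradYL f g x y u l) + (∑ i, bg.2 i • gradY (g i) x y) = 0 ∧
    (∀ i, 0 < u i ∧ g i (x, y) = 0 → (∑ l, bg.1 l * gradY (g i) x y l) = 0) ∧
    (∀ i, u i = 0 ∧ g i (x, y) < 0 → bg.2 i = 0) ∧
    (∀ i, u i = 0 ∧ g i (x, y) = 0 →
      0 ≤ bg.2 i * (∑ l, bg.1 l * gradY (g i) x y l))}

/-- Condition `(A₁ᶜ)`. -/
def A1c {n m q : ℕ} (f : Euc n × Euc m → ℝ) (g : Fin q → Euc n × Euc m → ℝ)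
    (x : Euc n) (y : Euc m) (u : Euc q) : Prop :=
  ∀ bg ∈ LambdaEC f g x y u 0, bg.1 = 0 ∧ bg.2 = 0

/-- Condition `(A₂ᶜ)`. -/
def A2c {n m q : ℕ} (f : Euc n × Euc m → ℝ) (g : Fin q → Euc n × Euc m → ℝ)
    (x : Euc n) (y : Euc m) (u : Euc q) : Prop :=
  ∀ bg ∈ LambdaYEC f g x y u 0,
    (∑ l, bg.1 l • gradXL f g x y u l) + (∑ i, bg.2 i • gradX (g i) x y) = 0

/-- The C-stationarity conditions at `x` with witness `(y,u)` and multipliers `(α,β,γ)`. -/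
def CStationaryWith {n m p q : ℕ} (F f : Euc n × Euc m → ℝ) (g : Fin q → Euc n × Euc m → ℝ)
    (G : Fin p → Euc n → ℝ) (x : Euc n) (y : Euc m) (u : Euc q)
    (α : Fin p → ℝ) (β : Fin m → ℝ) (γ : Fin q → ℝ) : Prop :=
  gradX F x y + (∑ j, α j • gradient (G j) x) + (∑ l, β l • gradXL f g x y u l)
      + (∑ i, γ i • gradX (g i) x y) = 0 ∧
  gradY F x y + (∑ l, β l • gradYL f g x y u l) + (∑ i, γ i • gradY (g i) x y) = 0 ∧
  (∀ j, 0 ≤ α j ∧ G j x ≤ 0 ∧ α j * G j x = 0) ∧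
  (∀ i, 0 < u i ∧ g i (x, y) = 0 → (∑ l, β l * gradY (g i) x y l) = 0) ∧
  (∀ i, u i = 0 ∧ g i (x, y) < 0 → γ i = 0) ∧
  (∀ i, u i = 0 ∧ g i (x, y) = 0 → 0 ≤ γ i * (∑ l, β l * gradY (g i) x y l))

/-- `x` is a C-stationary point. -/
def CStationary {n m p q : ℕ} (F f : Euc n × Euc m → ℝ) (g : Fin q → Euc n × Euc m → ℝ)
    (G : Fin p → Euc n → ℝ) (x : Euc n) : Prop :=
  ∃ y u, (y, u) ∈ SpSet F f g x ∧ ∃ α β γ, CStationaryWith F f g G x y u α β γ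

/-- The stationarity system for the relaxed problem with parameter `t`. -/
def RelaxedStationary {n m p q : ℕ} (F f : Euc n × Euc m → ℝ) (g : Fin q → Euc n × Euc m → ℝ)
    (G : Fin p → Euc n → ℝ) (t : ℝ) (x : Euc n) (y : Euc m) (u : Euc q)
    (α : Fin p → ℝ) (β : Fin m → ℝ) (γ μ δ : Fin q → ℝ) : Prop :=
  (y, u) ∈ SpTSet F f g t x ∧
  gradX F x y + (∑ j, α j • gradient (G j) x) - (∑ l, β l • gradXL f g x y u l)
      - (∑ i, (γ i - δ i * u i) • gradX (g i) x y) = 0 ∧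
  gradY F x y - (∑ l, β l • gradYL f g x y u l)
      - (∑ i, (γ i - δ i * u i) • gradY (g i) x y) = 0 ∧
  (∀ i, -(∑ l, β l * gradY (g i) x y l) + μ i + δ i * g i (x, y) = 0) ∧
  (∀ j, 0 ≤ α j ∧ G j x ≤ 0 ∧ α j * G j x = 0) ∧
  (∀ i, 0 ≤ γ i ∧ g i (x, y) ≤ 0 ∧ γ i * g i (x, y) = 0) ∧
  (∀ i, 0 ≤ μ i ∧ 0 ≤ u i ∧ μ i * u i = 0) ∧
  (∀ i, 0 ≤ δ i ∧ -(u i * g i (x, y)) ≤ t ∧ δ i * (u i * g i (x, y) + t) = 0)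

/-- Lower-level optimal solution map `S(x)`. -/
def lowerS {n m q : ℕ} (f : Euc n × Euc m → ℝ) (g : Fin q → Euc n × Euc m → ℝ) (x : Euc n) :
    Set (Euc m) :=
  {y | (∀ i, g i (x, y) ≤ 0) ∧ ∀ y', (∀ i, g i (x, y') ≤ 0) → f (x, y) ≤ f (x, y')}

/-- Pessimistic value function `φ_p(x)`. -/
noncomputable def phiP {n m q : ℕ} (F f : Euc n × Euc m → ℝ)
    (g : Fin q → Euc n × Euc m → ℝ) (x : Euc n) : ℝ :=
  sSup ((fun y => F (x, y)) '' lowerS f g x)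


/-- `Ψ` is Lipschitz-like (Aubin continuous) around `(xb, zb)` with modulus `τ`. -/
def LipschitzLike {n m q : ℕ} (Ψ : Euc n → Set (Euc m × Euc q)) (xb : Euc n)
    (zb : Euc m × Euc q) (τ : ℝ) : Prop :=
  ∃ U ∈ 𝓝 xb, ∃ V ∈ 𝓝 zb, ∀ x ∈ U, ∀ x' ∈ U, ∀ z ∈ Ψ x ∩ V,
    ∃ z' ∈ Ψ x', dist z z' ≤ τ * dist x x'

/-- `Ψ` is inner semicontinuous at the point `(xb, zb)` of its graph. -/
def InnerSemicontinuousAt {α β : Type*} [TopologicalSpace α] [TopologicalSpace β]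
    (Ψ : α → Set β) (xb : α) (zb : β) : Prop :=
  ∀ xk : ℕ → α, Tendsto xk atTop (𝓝 xb) →
    ∃ zk : ℕ → β, (∀ k, zk k ∈ Ψ (xk k)) ∧ Tendsto zk atTop (𝓝 zb)

theorem DSet_subset_DtSet {n m q : ℕ} (f : Euc n × Euc m → ℝ) (g : Fin q → Euc n × Euc m → ℝ)
    {t : ℝ} (ht : 0 ≤ t) (x : Euc n) : DSet f g x ⊆ DtSet f g t x :=
  fun _ hz => ⟨hz.1, fun i =>
    ⟨(hz.2 i).1, (hz.2 i).2.1, by rw [(hz.2 i).2.2, neg_zero]; exact ht⟩⟩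

theorem psiP_le_psiPt {n m q : ℕ} {F f : Euc n × Euc m → ℝ} {g : Fin q → Euc n × Euc m → ℝ}
    {t : ℝ} (ht : 0 ≤ t) {x : Euc n} (hne : (DSet f g x).Nonempty)
    (hbdd : BddAbove ((fun z : Euc m × Euc q => F (x, z.1)) '' DtSet f g t x)) :
    psiP F f g x ≤ psiPt F f g t x :=
  csSup_le_csSup hbdd (hne.image _) (image_mono (DSet_subset_DtSet f g ht x))

/-- a limit of local optimal solutions of the relaxed problems is a local
optimal solution of the KKT reformulation, under a distance condition on the
neighborhoods. -/
theorem stmt_7 {n m p q : ℕ} (hn : 0 < n) (hm : 0 < m) (hp : 0 < p) (hq : 0 < q)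
    (F f : Euc n × Euc m → ℝ) (g : Fin q → Euc n × Euc m → ℝ) (G : Fin p → Euc n → ℝ)
    (hf : ContDiff ℝ 1 f) (hg : ∀ i, ContDiff ℝ 1 (g i)) (hF : ContDiff ℝ 1 F)
    (hG : ∀ j, ContDiff ℝ 1 (G j))
    (hne : ∀ x ∈ upperX G, (DSet f g x).Nonempty)
    (hbdd : ∀ x ∈ upperX G, ∀ t : ℝ, 0 < t →
      BddAbove ((fun z : Euc m × Euc q => F (x, z.1)) '' DtSet f g t x))
    (xb : Euc n) (hlsc : LowerSemicontinuousAt (psiP F f g) xb)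
    (rb : ℝ) (hrb : 0 < rb)
    (husc : ∀ x : Euc n, dist x xb < rb →
      ∀ (tj : ℕ → ℝ) (uj : ℕ → Euc n), (∀ j, 0 < tj j) → Tendsto tj atTop (𝓝 0) →
        Tendsto uj atTop (𝓝 x) →
        ∀ ε > 0, ∀ᶠ j in atTop, psiPt F f g (tj j) (uj j) ≤ psiP F f g x + ε)
    (t : ℕ → ℝ) (htpos : ∀ k, 0 < t k) (ht0 : Tendsto t atTop (𝓝 0))
    (xk : ℕ → Euc n) (hxk : ∀ k, xk k ∈ upperX G)
    (r : ℕ → ℝ) (hr : ∀ k, 0 < r k)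
    (hloc : ∀ k, ∀ x ∈ upperX G, dist x (xk k) < r k →
      psiPt F f g (t k) (xk k) ≤ psiPt F f g (t k) x)
    (hconv : Tendsto xk atTop (𝓝 xb))
    (hdist : ∀ x ∈ upperX G, dist x xb < rb →
      Tendsto (fun k => Metric.infDist x (upperX G ∩ Metric.ball (xk k) (r k)))
        atTop (𝓝 0)) :
    xb ∈ upperX G ∧ ∀ x ∈ upperX G, dist x xb < rb → psiP F f g xb ≤ psiP F f g x := by
  have hX : IsClosed (upperX G) := by
    have h : upperX G = ⋂ j, {x | G j x ≤ 0} := by ext x; simp [upperX]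
    rw [h]
    exact isClosed_iInter fun j => isClosed_le (hG j).continuous continuous_const
  refine ⟨hX.mem_of_tendsto hconv (Eventually.of_forall hxk), fun x hx hxr => ?_⟩
  have hex : ∀ k, ∃ u ∈ upperX G ∩ ball (xk k) (r k),
      dist x u < infDist x (upperX G ∩ ball (xk k) (r k)) + 1 / ((k : ℝ) + 1) := by
    intro k
    have hk : (upperX G ∩ ball (xk k) (r k)).Nonempty := ⟨xk k, hxk k, mem_ball_self (hr k)⟩
    exact (infDist_lt_iff hk).1 (lt_add_of_pos_right _ Nat.one_div_pos_of_nat)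
  choose u hu hud using hex
  have hux : Tendsto u atTop (𝓝 x) := by
    rw [tendsto_iff_dist_tendsto_zero]
    have hlim := (hdist x hx hxr).add (tendsto_one_div_add_atTop_nhds_zero_nat (𝕜 := ℝ))
    rw [add_zero] at hlim
    refine squeeze_zero (fun _ => dist_nonneg) (fun k => ?_) hlim
    rw [dist_comm]
    exact (hud k).le
  refine le_of_forall_pos_le_add fun ε hε => ?_
  have hlow := hconv.eventually (hlsc (psiP F f g xb - ε / 2) (by linarith))
  have hupp := husc x hxr t u htpos ht0 hux (ε / 2) (half_pos hε)
  obtain ⟨k, hk₁, hk₂⟩ := (hlow.and hupp).exists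
  have hrelax := psiP_le_psiPt (htpos k).le (hne _ (hxk k)) (hbdd _ (hxk k) _ (htpos k))
  have hopt := hloc k (u k) (hu k).1 (hu k).2
  linarith

end
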